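/- Let G = (N, Σ, P, s) be a generative grammar all of whose productions have non-empty left- and right-hand sides, and let a1, …, an ∈ Σ. If the sequent Γ_G, a1, …, an → s is derivable in !wL1, then the sequent a1, …, an → s is derivable in L1 + T_G. -/

import Mathlib

namespace Lambek

/-! ## Formulae of `!bL1` (Lambek calculus with unit, brackets and subexponential) -/

/-- Formulae: primitive types, the unit `1`, `\`, `/`, `·`, `⟨⟩`, `[]⁻¹`, `!`. -/
inductive Fm : Type
  | var : ℕ → Fm
  | one : Fm
  | ldiv : Fm → Fm → Fm   -- `ldiv A C` is `A \ C`
  | rdiv : Fm → Fm → Fm   -- `rdiv C B` is `C / B`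
  | mul : Fm → Fm → Fm    -- `A · B`
  | dia : Fm → Fm         -- `⟨⟩ A`
  | binv : Fm → Fm        -- `[]⁻¹ A`
  | bang : Fm → Fm        -- `! A`

/-- Items of a meta-formula: a formula or a bracketed meta-formula. -/
inductive Item : Type
  | fm : Fm → Item
  | br : List Item → Item

/-- Meta-formulae (configurations): finite ordered sequences of items. -/
abbrev Meta := List Item

/-- `!A₁, …, !Aₙ` as a meta-formula. -/
def bangs (Φ : List Fm) : Meta := Φ.map (fun F => Item.fm (Fm.bang F))

/-- A meta-formula with a designated (hole) occurrence of a meta-formula,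
possibly under nested brackets. -/
inductive Ctx : Type
  | hole : Meta → Meta → Ctx
  | br : Meta → Ctx → Meta → Ctx

/-- Plug a meta-formula into the designated occurrence. -/
def Ctx.fill : Ctx → Meta → Meta
  | Ctx.hole Δ₁ Δ₂, Γ => Δ₁ ++ Γ ++ Δ₂
  | Ctx.br Δ₁ c Δ₂, Γ => Δ₁ ++ (Item.br (c.fill Γ)) :: Δ₂

/-- Derivability in `!bL1`.  The boolean parameter says whether the rule (cut)
is allowed: `DervB true` is full `!bL1`, `DervB false` is cut-free derivability. -/
inductive DervB : Bool → Meta → Fm → Prop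
  | id (cf : Bool) (A : Fm) : DervB cf [Item.fm A] A
  | one_r (cf : Bool) : DervB cf [] Fm.one
  | rdiv_l (cf : Bool) (Δ : Ctx) (Γ : Meta) (B C D : Fm) :
      DervB cf Γ B → DervB cf (Δ.fill [Item.fm C]) D →
      DervB cf (Δ.fill (Item.fm (Fm.rdiv C B) :: Γ)) D
  | rdiv_r (cf : Bool) (Γ : Meta) (B C : Fm) :
      DervB cf (Γ ++ [Item.fm B]) C → DervB cf Γ (Fm.rdiv C B)
  | ldiv_l (cf : Bool) (Δ : Ctx) (Γ : Meta) (A C D : Fm) :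
      DervB cf Γ A → DervB cf (Δ.fill [Item.fm C]) D →
      DervB cf (Δ.fill (Γ ++ [Item.fm (Fm.ldiv A C)])) D
  | ldiv_r (cf : Bool) (Γ : Meta) (A C : Fm) :
      DervB cf (Item.fm A :: Γ) C → DervB cf Γ (Fm.ldiv A C)
  | mul_l (cf : Bool) (Δ : Ctx) (A B D : Fm) :
      DervB cf (Δ.fill [Item.fm A, Item.fm B]) D →
      DervB cf (Δ.fill [Item.fm (Fm.mul A B)]) D
  | mul_r (cf : Bool) (Γ₁ Γ₂ : Meta) (A B : Fm) :
      DervB cf Γ₁ A → DervB cf Γ₂ B → DervB cf (Γ₁ ++ Γ₂) (Fm.mul A B)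
  | one_l (cf : Bool) (Δ : Ctx) (A : Fm) :
      DervB cf (Δ.fill []) A → DervB cf (Δ.fill [Item.fm Fm.one]) A
  | dia_l (cf : Bool) (Δ : Ctx) (A C : Fm) :
      DervB cf (Δ.fill [Item.br [Item.fm A]]) C →
      DervB cf (Δ.fill [Item.fm (Fm.dia A)]) C
  | dia_r (cf : Bool) (Θ : Meta) (A : Fm) :
      DervB cf Θ A → DervB cf [Item.br Θ] (Fm.dia A)
  | binv_l (cf : Bool) (Δ : Ctx) (A C : Fm) :
      DervB cf (Δ.fill [Item.fm A]) C →
      DervB cf (Δ.fill [Item.br [Item.fm (Fm.binv A)]]) C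
  | binv_r (cf : Bool) (Θ : Meta) (A : Fm) :
      DervB cf [Item.br Θ] A → DervB cf Θ (Fm.binv A)
  | bang_l (cf : Bool) (Δ : Ctx) (A B : Fm) :
      DervB cf (Δ.fill [Item.fm A]) B → DervB cf (Δ.fill [Item.fm (Fm.bang A)]) B
  | bang_r (cf : Bool) (Φ : List Fm) (A : Fm) :
      DervB cf (bangs Φ) A → DervB cf (bangs Φ) (Fm.bang A)
  | contr (cf : Bool) (Δ : Ctx) (Φ : List Fm) (Γ : Meta) (B : Fm) :
      Φ ≠ [] →
      DervB cf (Δ.fill (bangs Φ ++ [Item.br (bangs Φ ++ Γ)])) B →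
      DervB cf (Δ.fill (bangs Φ ++ Γ)) B
  | perm1 (cf : Bool) (Δ : Ctx) (A : Fm) (Γ : Meta) (B : Fm) :
      DervB cf (Δ.fill (Item.fm (Fm.bang A) :: Γ)) B →
      DervB cf (Δ.fill (Γ ++ [Item.fm (Fm.bang A)])) B
  | perm2 (cf : Bool) (Δ : Ctx) (A : Fm) (Γ : Meta) (B : Fm) :
      DervB cf (Δ.fill (Γ ++ [Item.fm (Fm.bang A)])) B →
      DervB cf (Δ.fill (Item.fm (Fm.bang A) :: Γ)) B
  | cut (Δ : Ctx) (Θ : Meta) (A C : Fm) :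
      DervB true Θ A → DervB true (Δ.fill [Item.fm A]) C →
      DervB true (Δ.fill Θ) C

/-! ## Bracket-free formulae and the calculi `!L1` and `!wL1` -/

/-- Bracket-free formulae (language of `!L1` / `!wL1`). -/
inductive Fm0 : Type
  | var : ℕ → Fm0
  | one : Fm0
  | ldiv : Fm0 → Fm0 → Fm0
  | rdiv : Fm0 → Fm0 → Fm0
  | mul : Fm0 → Fm0 → Fm0
  | bang : Fm0 → Fm0

/-- Derivability in `!L1` / `!wL1`.  The first boolean allows the weakening
rule (`DervL true` is `!wL1`, `DervL false` is `!L1`); the second boolean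
allows the rule (cut). -/
inductive DervL : Bool → Bool → List Fm0 → Fm0 → Prop
  | id (w cf : Bool) (A : Fm0) : DervL w cf [A] A
  | one_r (w cf : Bool) : DervL w cf [] Fm0.one
  | rdiv_l (w cf : Bool) (Γ Δ₁ Δ₂ : List Fm0) (B C D : Fm0) :
      DervL w cf Γ B → DervL w cf (Δ₁ ++ C :: Δ₂) D →
      DervL w cf (Δ₁ ++ Fm0.rdiv C B :: (Γ ++ Δ₂)) D
  | rdiv_r (w cf : Bool) (Γ : List Fm0) (B C : Fm0) :
      DervL w cf (Γ ++ [B]) C → DervL w cf Γ (Fm0.rdiv C B)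
  | ldiv_l (w cf : Bool) (Γ Δ₁ Δ₂ : List Fm0) (A C D : Fm0) :
      DervL w cf Γ A → DervL w cf (Δ₁ ++ C :: Δ₂) D →
      DervL w cf (Δ₁ ++ Γ ++ Fm0.ldiv A C :: Δ₂) D
  | ldiv_r (w cf : Bool) (Γ : List Fm0) (A C : Fm0) :
      DervL w cf (A :: Γ) C → DervL w cf Γ (Fm0.ldiv A C)
  | mul_l (w cf : Bool) (Δ₁ Δ₂ : List Fm0) (A B D : Fm0) :
      DervL w cf (Δ₁ ++ A :: B :: Δ₂) D → DervL w cf (Δ₁ ++ Fm0.mul A B :: Δ₂) D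
  | mul_r (w cf : Bool) (Γ₁ Γ₂ : List Fm0) (A B : Fm0) :
      DervL w cf Γ₁ A → DervL w cf Γ₂ B → DervL w cf (Γ₁ ++ Γ₂) (Fm0.mul A B)
  | one_l (w cf : Bool) (Δ₁ Δ₂ : List Fm0) (A : Fm0) :
      DervL w cf (Δ₁ ++ Δ₂) A → DervL w cf (Δ₁ ++ Fm0.one :: Δ₂) A
  | bang_l (w cf : Bool) (Δ₁ Δ₂ : List Fm0) (A B : Fm0) :
      DervL w cf (Δ₁ ++ A :: Δ₂) B → DervL w cf (Δ₁ ++ Fm0.bang A :: Δ₂) B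
  | bang_r (w cf : Bool) (Φ : List Fm0) (A : Fm0) :
      DervL w cf (Φ.map Fm0.bang) A → DervL w cf (Φ.map Fm0.bang) (Fm0.bang A)
  | perm1 (w cf : Bool) (Δ₁ Γ Δ₂ : List Fm0) (A B : Fm0) :
      DervL w cf (Δ₁ ++ Fm0.bang A :: (Γ ++ Δ₂)) B →
      DervL w cf (Δ₁ ++ Γ ++ Fm0.bang A :: Δ₂) B
  | perm2 (w cf : Bool) (Δ₁ Γ Δ₂ : List Fm0) (A B : Fm0) :
      DervL w cf (Δ₁ ++ Γ ++ Fm0.bang A :: Δ₂) B →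
      DervL w cf (Δ₁ ++ Fm0.bang A :: (Γ ++ Δ₂)) B
  | contr (w cf : Bool) (Δ₁ Δ₂ : List Fm0) (A B : Fm0) :
      DervL w cf (Δ₁ ++ Fm0.bang A :: Fm0.bang A :: Δ₂) B →
      DervL w cf (Δ₁ ++ Fm0.bang A :: Δ₂) B
  | weak (cf : Bool) (Δ₁ Δ₂ : List Fm0) (A B : Fm0) :
      DervL true cf (Δ₁ ++ Δ₂) B → DervL true cf (Δ₁ ++ Fm0.bang A :: Δ₂) B
  | cut (w : Bool) (Θ Δ₁ Δ₂ : List Fm0) (A C : Fm0) :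
      DervL w true Θ A → DervL w true (Δ₁ ++ A :: Δ₂) C →
      DervL w true (Δ₁ ++ Θ ++ Δ₂) C

/-! ## The Lambek calculus with unit `L1` and theories `L1 + T` -/

/-- Formulae of `L1` (no `!`, no bracket modalities). -/
inductive Fm1 : Type
  | var : ℕ → Fm1
  | one : Fm1
  | ldiv : Fm1 → Fm1 → Fm1
  | rdiv : Fm1 → Fm1 → Fm1
  | mul : Fm1 → Fm1 → Fm1

/-- Sequents of `L1`. -/
abbrev Seq1 := List Fm1 × Fm1

/-- Derivability in `L1 + T` (sequents of `T` are extra axioms). -/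
inductive DervT (T : Set Seq1) : List Fm1 → Fm1 → Prop
  | id (A : Fm1) : DervT T [A] A
  | one_r : DervT T [] Fm1.one
  | ax (Γ : List Fm1) (A : Fm1) : (Γ, A) ∈ T → DervT T Γ A
  | rdiv_l (Γ Δ₁ Δ₂ : List Fm1) (B C D : Fm1) :
      DervT T Γ B → DervT T (Δ₁ ++ C :: Δ₂) D →
      DervT T (Δ₁ ++ Fm1.rdiv C B :: (Γ ++ Δ₂)) D
  | rdiv_r (Γ : List Fm1) (B C : Fm1) :
      DervT T (Γ ++ [B]) C → DervT T Γ (Fm1.rdiv C B)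
  | ldiv_l (Γ Δ₁ Δ₂ : List Fm1) (A C D : Fm1) :
      DervT T Γ A → DervT T (Δ₁ ++ C :: Δ₂) D →
      DervT T (Δ₁ ++ Γ ++ Fm1.ldiv A C :: Δ₂) D
  | ldiv_r (Γ : List Fm1) (A C : Fm1) :
      DervT T (A :: Γ) C → DervT T Γ (Fm1.ldiv A C)
  | mul_l (Δ₁ Δ₂ : List Fm1) (A B D : Fm1) :
      DervT T (Δ₁ ++ A :: B :: Δ₂) D → DervT T (Δ₁ ++ Fm1.mul A B :: Δ₂) D
  | mul_r (Γ₁ Γ₂ : List Fm1) (A B : Fm1) :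
      DervT T Γ₁ A → DervT T Γ₂ B → DervT T (Γ₁ ++ Γ₂) (Fm1.mul A B)
  | one_l (Δ₁ Δ₂ : List Fm1) (A : Fm1) :
      DervT T (Δ₁ ++ Δ₂) A → DervT T (Δ₁ ++ Fm1.one :: Δ₂) A
  | cut (Θ Δ₁ Δ₂ : List Fm1) (A C : Fm1) :
      DervT T Θ A → DervT T (Δ₁ ++ A :: Δ₂) C →
      DervT T (Δ₁ ++ Θ ++ Δ₂) C

/-- Derivability in `L1 + T` where every application of (cut) must have a
sequent from `T` as one of its premises. -/
inductive DervTr (T : Set Seq1) : List Fm1 → Fm1 → Prop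
  | id (A : Fm1) : DervTr T [A] A
  | one_r : DervTr T [] Fm1.one
  | ax (Γ : List Fm1) (A : Fm1) : (Γ, A) ∈ T → DervTr T Γ A
  | rdiv_l (Γ Δ₁ Δ₂ : List Fm1) (B C D : Fm1) :
      DervTr T Γ B → DervTr T (Δ₁ ++ C :: Δ₂) D →
      DervTr T (Δ₁ ++ Fm1.rdiv C B :: (Γ ++ Δ₂)) D
  | rdiv_r (Γ : List Fm1) (B C : Fm1) :
      DervTr T (Γ ++ [B]) C → DervTr T Γ (Fm1.rdiv C B)
  | ldiv_l (Γ Δ₁ Δ₂ : List Fm1) (A C D : Fm1) :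
      DervTr T Γ A → DervTr T (Δ₁ ++ C :: Δ₂) D →
      DervTr T (Δ₁ ++ Γ ++ Fm1.ldiv A C :: Δ₂) D
  | ldiv_r (Γ : List Fm1) (A C : Fm1) :
      DervTr T (A :: Γ) C → DervTr T Γ (Fm1.ldiv A C)
  | mul_l (Δ₁ Δ₂ : List Fm1) (A B D : Fm1) :
      DervTr T (Δ₁ ++ A :: B :: Δ₂) D → DervTr T (Δ₁ ++ Fm1.mul A B :: Δ₂) D
  | mul_r (Γ₁ Γ₂ : List Fm1) (A B : Fm1) :
      DervTr T Γ₁ A → DervTr T Γ₂ B → DervTr T (Γ₁ ++ Γ₂) (Fm1.mul A B)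
  | one_l (Δ₁ Δ₂ : List Fm1) (A : Fm1) :
      DervTr T (Δ₁ ++ Δ₂) A → DervTr T (Δ₁ ++ Fm1.one :: Δ₂) A
  | cut (Θ Δ₁ Δ₂ : List Fm1) (A C : Fm1) :
      (Θ, A) ∈ T ∨ (Δ₁ ++ A :: Δ₂, C) ∈ T →
      DervTr T Θ A → DervTr T (Δ₁ ++ A :: Δ₂) C →
      DervTr T (Δ₁ ++ Θ ++ Δ₂) C

/-- Derivability in `L1 + T` by a derivation all of whose sequents satisfy
the predicate `Good`. -/
inductive DervTgood (T : Set Seq1) (Good : List Fm1 → Fm1 → Prop) : List Fm1 → Fm1 → Prop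
  | id (A : Fm1) : Good [A] A → DervTgood T Good [A] A
  | one_r : Good [] Fm1.one → DervTgood T Good [] Fm1.one
  | ax (Γ : List Fm1) (A : Fm1) : (Γ, A) ∈ T → Good Γ A → DervTgood T Good Γ A
  | rdiv_l (Γ Δ₁ Δ₂ : List Fm1) (B C D : Fm1) :
      DervTgood T Good Γ B → DervTgood T Good (Δ₁ ++ C :: Δ₂) D →
      Good (Δ₁ ++ Fm1.rdiv C B :: (Γ ++ Δ₂)) D →
      DervTgood T Good (Δ₁ ++ Fm1.rdiv C B :: (Γ ++ Δ₂)) D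
  | rdiv_r (Γ : List Fm1) (B C : Fm1) :
      DervTgood T Good (Γ ++ [B]) C → Good Γ (Fm1.rdiv C B) →
      DervTgood T Good Γ (Fm1.rdiv C B)
  | ldiv_l (Γ Δ₁ Δ₂ : List Fm1) (A C D : Fm1) :
      DervTgood T Good Γ A → DervTgood T Good (Δ₁ ++ C :: Δ₂) D →
      Good (Δ₁ ++ Γ ++ Fm1.ldiv A C :: Δ₂) D →
      DervTgood T Good (Δ₁ ++ Γ ++ Fm1.ldiv A C :: Δ₂) D
  | ldiv_r (Γ : List Fm1) (A C : Fm1) :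
      DervTgood T Good (A :: Γ) C → Good Γ (Fm1.ldiv A C) →
      DervTgood T Good Γ (Fm1.ldiv A C)
  | mul_l (Δ₁ Δ₂ : List Fm1) (A B D : Fm1) :
      DervTgood T Good (Δ₁ ++ A :: B :: Δ₂) D →
      Good (Δ₁ ++ Fm1.mul A B :: Δ₂) D →
      DervTgood T Good (Δ₁ ++ Fm1.mul A B :: Δ₂) D
  | mul_r (Γ₁ Γ₂ : List Fm1) (A B : Fm1) :
      DervTgood T Good Γ₁ A → DervTgood T Good Γ₂ B →
      Good (Γ₁ ++ Γ₂) (Fm1.mul A B) →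
      DervTgood T Good (Γ₁ ++ Γ₂) (Fm1.mul A B)
  | one_l (Δ₁ Δ₂ : List Fm1) (A : Fm1) :
      DervTgood T Good (Δ₁ ++ Δ₂) A → Good (Δ₁ ++ Fm1.one :: Δ₂) A →
      DervTgood T Good (Δ₁ ++ Fm1.one :: Δ₂) A
  | cut (Θ Δ₁ Δ₂ : List Fm1) (A C : Fm1) :
      DervTgood T Good Θ A → DervTgood T Good (Δ₁ ++ A :: Δ₂) C →
      Good (Δ₁ ++ Θ ++ Δ₂) C →
      DervTgood T Good (Δ₁ ++ Θ ++ Δ₂) C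

/-- The formula is built from primitive types using only the product `·`. -/
def ProdOnly : Fm1 → Prop
  | Fm1.var _ => True
  | Fm1.mul A B => ProdOnly A ∧ ProdOnly B
  | _ => False

/-- A sequent contains no occurrences of `\`, `/`, `1`. -/
def ProdOnlySeq (Γ : List Fm1) (A : Fm1) : Prop :=
  (∀ F ∈ Γ, ProdOnly F) ∧ ProdOnly A

/-! ## The bracket-forgetting projection -/

/-- BFP on formulae: delete all `⟨⟩` and `[]⁻¹`. -/
def fmBFP : Fm → Fm0
  | Fm.var n => Fm0.var n
  | Fm.one => Fm0.one
  | Fm.ldiv A B => Fm0.ldiv (fmBFP A) (fmBFP B)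
  | Fm.rdiv A B => Fm0.rdiv (fmBFP A) (fmBFP B)
  | Fm.mul A B => Fm0.mul (fmBFP A) (fmBFP B)
  | Fm.dia A => fmBFP A
  | Fm.binv A => fmBFP A
  | Fm.bang A => Fm0.bang (fmBFP A)

mutual
  /-- BFP on items. -/
  def itemBFP : Item → List Fm0
    | Item.fm A => [fmBFP A]
    | Item.br Γ => metaBFP Γ
  /-- BFP on meta-formulae: delete all brackets. -/
  def metaBFP : List Item → List Fm0
    | [] => []
    | i :: Γ => itemBFP i ++ metaBFP Γ
end

/-! ## Generative grammars (semi-Thue systems) -/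

/-- A generative grammar (semi-Thue system) over symbols coded by `ℕ`. -/
structure Grammar where
  nonterminals : Finset ℕ
  terminals : Finset ℕ
  disj : Disjoint nonterminals terminals
  start : ℕ
  start_mem : start ∈ nonterminals
  prods : Finset (List ℕ × List ℕ)
  prods_wf : ∀ p ∈ prods,
    (∀ c ∈ p.1, c ∈ nonterminals ∪ terminals) ∧
    (∀ c ∈ p.2, c ∈ nonterminals ∪ terminals)

/-- One rewriting step `η α θ ⇒_G η β θ`. -/
def Grammar.Step (G : Grammar) (x y : List ℕ) : Prop :=
  ∃ p ∈ G.prods, ∃ η θ : List ℕ, x = η ++ p.1 ++ θ ∧ y = η ++ p.2 ++ θ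

/-- `⇒*_G`: reflexive-transitive closure of `⇒_G`. -/
def Grammar.Derives (G : Grammar) : List ℕ → List ℕ → Prop :=
  Relation.ReflTransGen G.Step

/-- All productions of `G` have nonempty left- and right-hand sides. -/
def Grammar.NonemptySides (G : Grammar) : Prop :=
  ∀ p ∈ G.prods, p.1 ≠ [] ∧ p.2 ≠ []

/-! ### Encoding grammars into formulae -/

/-- `u₁ · … · u_k` as an `Fm`-formula (`1` for the empty word). -/
def wordFm : List ℕ → Fm
  | [] => Fm.one
  | [a] => Fm.var a
  | a :: b :: rest => Fm.mul (Fm.var a) (wordFm (b :: rest))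

/-- `u₁ · … · u_k` as an `Fm0`-formula. -/
def wordFm0 : List ℕ → Fm0
  | [] => Fm0.one
  | [a] => Fm0.var a
  | a :: b :: rest => Fm0.mul (Fm0.var a) (wordFm0 (b :: rest))

/-- `u₁ · … · u_k` as an `Fm1`-formula. -/
def wordFm1 : List ℕ → Fm1
  | [] => Fm1.one
  | [a] => Fm1.var a
  | a :: b :: rest => Fm1.mul (Fm1.var a) (wordFm1 (b :: rest))

/-- The formula `(u₁·…·u_k) / (v₁·…·v_m)` for a production `u ⇒ v`, in `Fm`. -/
def prodFm (p : List ℕ × List ℕ) : Fm := Fm.rdiv (wordFm p.1) (wordFm p.2)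

/-- The formula `(u₁·…·u_k) / (v₁·…·v_m)` for a production `u ⇒ v`, in `Fm0`. -/
def prodFm0 (p : List ℕ × List ℕ) : Fm0 := Fm0.rdiv (wordFm0 p.1) (wordFm0 p.2)

/-- `Γ_G = !B₁, …, !Bₙ` (bracket-free). -/
noncomputable def GammaG (G : Grammar) : List Fm0 :=
  G.prods.toList.map (fun p => Fm0.bang (prodFm0 p))

/-- `Φ_G = !(1 / !B₁), …, !(1 / !Bₙ)` (bracket-free). -/
noncomputable def PhiG (G : Grammar) : List Fm0 :=
  G.prods.toList.map (fun p => Fm0.bang (Fm0.rdiv Fm0.one (Fm0.bang (prodFm0 p))))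

/-- `Γ̃_G = ![]⁻¹B₁, …, ![]⁻¹Bₙ`. -/
noncomputable def GammaTG (G : Grammar) : Meta :=
  G.prods.toList.map (fun p => Item.fm (Fm.bang (Fm.binv (prodFm p))))

/-- `Φ̃_G = !(1 / ![]⁻¹B₁), …, !(1 / ![]⁻¹Bₙ)`. -/
noncomputable def PhiTG (G : Grammar) : Meta :=
  G.prods.toList.map
    (fun p => Item.fm (Fm.bang (Fm.rdiv Fm.one (Fm.bang (Fm.binv (prodFm p))))))

/-- The theory `T_G = { v₁, …, v_m → u₁·…·u_k : (u ⇒ v) ∈ P }`. -/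
def TG (G : Grammar) : Set Seq1 :=
  { q | ∃ p ∈ G.prods, q = (p.2.map Fm1.var, wordFm1 p.1) }

/-! ## Effective encodings of sequents into `ℕ` -/

/-- An effective injective code of `!bL1`-formulae. -/
def encFm : Fm → ℕ
  | Fm.var n => Nat.pair 0 n
  | Fm.one => Nat.pair 1 0
  | Fm.ldiv A B => Nat.pair 2 (Nat.pair (encFm A) (encFm B))
  | Fm.rdiv A B => Nat.pair 3 (Nat.pair (encFm A) (encFm B))
  | Fm.mul A B => Nat.pair 4 (Nat.pair (encFm A) (encFm B))
  | Fm.dia A => Nat.pair 5 (encFm A)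
  | Fm.binv A => Nat.pair 6 (encFm A)
  | Fm.bang A => Nat.pair 7 (encFm A)

mutual
  /-- An effective injective code of items. -/
  def encItem : Item → ℕ
    | Item.fm A => Nat.pair 0 (encFm A)
    | Item.br Γ => Nat.pair 1 (encMeta Γ)
  /-- An effective injective code of meta-formulae. -/
  def encMeta : List Item → ℕ
    | [] => 0
    | i :: Γ => Nat.pair (encItem i) (encMeta Γ) + 1
end

/-- An effective injective code of `!bL1`-sequents. -/
def encSeqB (Γ : Meta) (A : Fm) : ℕ := Nat.pair (encMeta Γ) (encFm A)

/-- An effective injective code of bracket-free formulae. -/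
def encFm0 : Fm0 → ℕ
  | Fm0.var n => Nat.pair 0 n
  | Fm0.one => Nat.pair 1 0
  | Fm0.ldiv A B => Nat.pair 2 (Nat.pair (encFm0 A) (encFm0 B))
  | Fm0.rdiv A B => Nat.pair 3 (Nat.pair (encFm0 A) (encFm0 B))
  | Fm0.mul A B => Nat.pair 4 (Nat.pair (encFm0 A) (encFm0 B))
  | Fm0.bang A => Nat.pair 5 (encFm0 A)

/-- An effective injective code of `!L1`/`!wL1`-sequents. -/
def encSeq0 (Γ : List Fm0) (A : Fm0) : ℕ :=
  Nat.pair ((Γ.map encFm0).foldr (fun a r => Nat.pair a r + 1) 0) (encFm0 A)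

/-! ## Sizes -/

/-- Size (number of symbols) of a formula. -/
def fmSize : Fm → ℕ
  | Fm.var _ => 1
  | Fm.one => 1
  | Fm.ldiv A B => fmSize A + fmSize B + 1
  | Fm.rdiv A B => fmSize A + fmSize B + 1
  | Fm.mul A B => fmSize A + fmSize B + 1
  | Fm.dia A => fmSize A + 1
  | Fm.binv A => fmSize A + 1
  | Fm.bang A => fmSize A + 1

mutual
  /-- Size of an item. -/
  def itemSize : Item → ℕ
    | Item.fm A => fmSize A
    | Item.br Γ => metaSize Γ + 1
  /-- Size of a meta-formula. -/
  def metaSize : List Item → ℕ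
    | [] => 0
    | i :: Γ => itemSize i + metaSize Γ
end

/-! ## Polarity and the bracket non-negative condition -/

/-- `cleanFm pol A`: the formula `A`, all of whose subformula occurrences have
their polarity in the sequent tracked starting from `pol` (`true` = positive),
contains no `[]⁻¹`-subformula at positive polarity and no `⟨⟩`-subformula at
negative polarity. -/
def cleanFm : Bool → Fm → Prop
  | _, Fm.var _ => True
  | _, Fm.one => True
  | pol, Fm.ldiv A B => cleanFm (!pol) A ∧ cleanFm pol B
  | pol, Fm.rdiv B A => cleanFm pol B ∧ cleanFm (!pol) A
  | pol, Fm.mul A B => cleanFm pol A ∧ cleanFm pol B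
  | pol, Fm.dia A => pol = true ∧ cleanFm pol A
  | pol, Fm.binv A => pol = false ∧ cleanFm pol A
  | pol, Fm.bang A => cleanFm pol A

/-- `bnnFm pol A`: every negative occurrence of a `!`-subformula of `A`
(where `A` itself occurs at polarity `pol` in the sequent) includes no
positive occurrence of `[]⁻¹C` and no negative occurrence of `⟨⟩C`. -/
def bnnFm : Bool → Fm → Prop
  | _, Fm.var _ => True
  | _, Fm.one => True
  | pol, Fm.ldiv A B => bnnFm (!pol) A ∧ bnnFm pol B
  | pol, Fm.rdiv B A => bnnFm pol B ∧ bnnFm (!pol) A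
  | pol, Fm.mul A B => bnnFm pol A ∧ bnnFm pol B
  | pol, Fm.dia A => bnnFm pol A
  | pol, Fm.binv A => bnnFm pol A
  | pol, Fm.bang A => (pol = false → cleanFm false A) ∧ bnnFm pol A

mutual
  /-- The bracket non-negative condition for an item of an antecedent. -/
  def bnnItem : Item → Prop
    | Item.fm A => bnnFm false A
    | Item.br Γ => bnnMeta Γ
  /-- The bracket non-negative condition for an antecedent. -/
  def bnnMeta : List Item → Prop
    | [] => True
    | i :: Γ => bnnItem i ∧ bnnMeta Γ
end

/-- The sequent `Γ → C` obeys the bracket non-negative condition. -/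
def bnnSeq (Γ : Meta) (C : Fm) : Prop := bnnMeta Γ ∧ bnnFm true C

/-! ## The formulation of `!bL1` with the generalized permutation rule -/

/-- `interleave Δ₀ [(A₁,Δ₁), …, (A_k,Δ_k)] = Δ₀, !A₁, Δ₁, …, !A_k, Δ_k`. -/
def interleave : Meta → List (Fm × Meta) → Meta
  | Δ₀, [] => Δ₀
  | Δ₀, (A, Δ) :: rest => Δ₀ ++ Item.fm (Fm.bang A) :: interleave Δ rest

/-- Derivations in the formulation of `!bL1` in which `(perm₁)`, `(perm₂)` are
replaced by the generalized permutation rule `(perm)*`.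
`NDervP cf b n Γ C` means: there is a derivation of `Γ → C` in which
(cut) is allowed only if `cf = true`, no two applications of `(perm)*` are
consecutive, `b` records whether the last rule applied is `(perm)*`, and the
derivation has exactly `n` rule applications (axiom instances included). -/
inductive NDervP : Bool → Bool → ℕ → Meta → Fm → Prop
  | id (cf : Bool) (A : Fm) : NDervP cf false 1 [Item.fm A] A
  | one_r (cf : Bool) : NDervP cf false 1 [] Fm.one
  | rdiv_l (cf b₁ b₂ : Bool) (n₁ n₂ : ℕ) (Δ : Ctx) (Γ : Meta) (B C D : Fm) :
      NDervP cf b₁ n₁ Γ B → NDervP cf b₂ n₂ (Δ.fill [Item.fm C]) D →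
      NDervP cf false (n₁ + n₂ + 1) (Δ.fill (Item.fm (Fm.rdiv C B) :: Γ)) D
  | rdiv_r (cf b : Bool) (n : ℕ) (Γ : Meta) (B C : Fm) :
      NDervP cf b n (Γ ++ [Item.fm B]) C → NDervP cf false (n + 1) Γ (Fm.rdiv C B)
  | ldiv_l (cf b₁ b₂ : Bool) (n₁ n₂ : ℕ) (Δ : Ctx) (Γ : Meta) (A C D : Fm) :
      NDervP cf b₁ n₁ Γ A → NDervP cf b₂ n₂ (Δ.fill [Item.fm C]) D →
      NDervP cf false (n₁ + n₂ + 1) (Δ.fill (Γ ++ [Item.fm (Fm.ldiv A C)])) D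
  | ldiv_r (cf b : Bool) (n : ℕ) (Γ : Meta) (A C : Fm) :
      NDervP cf b n (Item.fm A :: Γ) C → NDervP cf false (n + 1) Γ (Fm.ldiv A C)
  | mul_l (cf b : Bool) (n : ℕ) (Δ : Ctx) (A B D : Fm) :
      NDervP cf b n (Δ.fill [Item.fm A, Item.fm B]) D →
      NDervP cf false (n + 1) (Δ.fill [Item.fm (Fm.mul A B)]) D
  | mul_r (cf b₁ b₂ : Bool) (n₁ n₂ : ℕ) (Γ₁ Γ₂ : Meta) (A B : Fm) :
      NDervP cf b₁ n₁ Γ₁ A → NDervP cf b₂ n₂ Γ₂ B →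
      NDervP cf false (n₁ + n₂ + 1) (Γ₁ ++ Γ₂) (Fm.mul A B)
  | one_l (cf b : Bool) (n : ℕ) (Δ : Ctx) (A : Fm) :
      NDervP cf b n (Δ.fill []) A → NDervP cf false (n + 1) (Δ.fill [Item.fm Fm.one]) A
  | dia_l (cf b : Bool) (n : ℕ) (Δ : Ctx) (A C : Fm) :
      NDervP cf b n (Δ.fill [Item.br [Item.fm A]]) C →
      NDervP cf false (n + 1) (Δ.fill [Item.fm (Fm.dia A)]) C
  | dia_r (cf b : Bool) (n : ℕ) (Θ : Meta) (A : Fm) :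
      NDervP cf b n Θ A → NDervP cf false (n + 1) [Item.br Θ] (Fm.dia A)
  | binv_l (cf b : Bool) (n : ℕ) (Δ : Ctx) (A C : Fm) :
      NDervP cf b n (Δ.fill [Item.fm A]) C →
      NDervP cf false (n + 1) (Δ.fill [Item.br [Item.fm (Fm.binv A)]]) C
  | binv_r (cf b : Bool) (n : ℕ) (Θ : Meta) (A : Fm) :
      NDervP cf b n [Item.br Θ] A → NDervP cf false (n + 1) Θ (Fm.binv A)
  | bang_l (cf b : Bool) (n : ℕ) (Δ : Ctx) (A B : Fm) :
      NDervP cf b n (Δ.fill [Item.fm A]) B →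
      NDervP cf false (n + 1) (Δ.fill [Item.fm (Fm.bang A)]) B
  | bang_r (cf b : Bool) (n : ℕ) (Φ : List Fm) (A : Fm) :
      NDervP cf b n (bangs Φ) A → NDervP cf false (n + 1) (bangs Φ) (Fm.bang A)
  | contr (cf b : Bool) (n : ℕ) (Δ : Ctx) (Φ : List Fm) (Γ : Meta) (B : Fm) :
      Φ ≠ [] →
      NDervP cf b n (Δ.fill (bangs Φ ++ [Item.br (bangs Φ ++ Γ)])) B →
      NDervP cf false (n + 1) (Δ.fill (bangs Φ ++ Γ)) B
  | permStar (cf : Bool) (n : ℕ) (Δ : Ctx) (Δ₀ : Meta) (L L' : List (Fm × Meta)) (C : Fm) :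
      L.map Prod.snd = L'.map Prod.snd →
      (L.map Prod.fst).Perm (L'.map Prod.fst) →
      NDervP cf false n (Δ.fill (interleave Δ₀ L)) C →
      NDervP cf true (n + 1) (Δ.fill (interleave Δ₀ L')) C
  | cut (b₁ b₂ : Bool) (n₁ n₂ : ℕ) (Δ : Ctx) (Θ : Meta) (A C : Fm) :
      NDervP true b₁ n₁ Θ A → NDervP true b₂ n₂ (Δ.fill [Item.fm A]) C →
      NDervP true false (n₁ + n₂ + 1) (Δ.fill Θ) C

/-! ## Syntactic-monoid semantics of `!wL1`

Formulae are interpreted as sets of words that are closed for the Galois connection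
`(x, y) ⟂ w ↔ x ++ w ++ y ∈ L`, for a fixed language `L`. -/

/-- The words that belong to `L` in every two-sided context in which all words of `X` do. -/
def contextClosure (L X : Set (List ℕ)) : Set (List ℕ) :=
  { w | ∀ x y, (∀ u ∈ X, x ++ u ++ y ∈ L) → x ++ w ++ y ∈ L }

/-- A language is context closed if it is equal to its context closure. -/
def ContextClosed (L C : Set (List ℕ)) : Prop := contextClosure L C ⊆ C

theorem subset_contextClosure (L X : Set (List ℕ)) : X ⊆ contextClosure L X :=
  fun w hw _ _ h => h w hw

theorem append_mem_of_mem_contextClosure {L C X : Set (List ℕ)} (hC : ContextClosed L C)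
    {u v w : List ℕ} (h : ∀ x ∈ X, u ++ x ++ v ∈ C) (hw : w ∈ contextClosure L X) :
    u ++ w ++ v ∈ C := by
  refine hC fun p q hpq => ?_
  have := hw (p ++ u) (v ++ q) fun x hx => by simpa using hpq _ (h x hx)
  simpa using this

theorem contextClosed_contextClosure (L X : Set (List ℕ)) :
    ContextClosed L (contextClosure L X) :=
  fun _ hw x y h => hw x y fun _ hu => hu x y h

/-- Interpretation of formulae as context closed languages. -/
def interp (L : Set (List ℕ)) : Fm0 → Set (List ℕ)
  | Fm0.var a => contextClosure L {[a]}
  | Fm0.one => contextClosure L {[]}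
  | Fm0.ldiv A C => { w | ∀ u ∈ interp L A, u ++ w ∈ interp L C }
  | Fm0.rdiv C B => { w | ∀ u ∈ interp L B, w ++ u ∈ interp L C }
  | Fm0.mul A B => contextClosure L { w | ∃ u ∈ interp L A, ∃ v ∈ interp L B, w = u ++ v }
  | Fm0.bang A => contextClosure L { w | w = [] ∧ [] ∈ interp L A }

theorem contextClosed_interp (L : Set (List ℕ)) (A : Fm0) : ContextClosed L (interp L A) := by
  induction A with
  | var | one | mul | bang => exact contextClosed_contextClosure _ _
  | ldiv A C _ ih =>
    intro w hw u hu
    simpa using append_mem_of_mem_contextClosure ih (u := u) (v := [])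
      (fun x hx => by simpa using hx u hu) hw
  | rdiv C B ih _ =>
    intro w hw u hu
    simpa using append_mem_of_mem_contextClosure ih (u := []) (v := u)
      (fun x hx => by simpa using hx u hu) hw

/-- Interpretation of antecedents: the concatenation of the interpretations of the formulae. -/
def interpSeq (L : Set (List ℕ)) : List Fm0 → Set (List ℕ)
  | [] => {[]}
  | A :: Γ => { w | ∃ u ∈ interp L A, ∃ v ∈ interpSeq L Γ, w = u ++ v }

@[simp]
theorem mem_interpSeq_nil {L : Set (List ℕ)} {w : List ℕ} : w ∈ interpSeq L [] ↔ w = [] :=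
  Iff.rfl

theorem mem_interpSeq_cons {L : Set (List ℕ)} {A : Fm0} {Γ : List Fm0} {w : List ℕ} :
    w ∈ interpSeq L (A :: Γ) ↔ ∃ u ∈ interp L A, ∃ v ∈ interpSeq L Γ, w = u ++ v :=
  Iff.rfl

theorem mem_interpSeq_append {L : Set (List ℕ)} {Γ Δ : List Fm0} {w : List ℕ} :
    w ∈ interpSeq L (Γ ++ Δ) ↔ ∃ u ∈ interpSeq L Γ, ∃ v ∈ interpSeq L Δ, w = u ++ v := by
  induction Γ generalizing w with
  | nil => simp
  | cons A Γ ih =>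
    simp only [List.cons_append, mem_interpSeq_cons, ih]
    constructor
    · rintro ⟨a, ha, _, ⟨u, hu, v, hv, rfl⟩, rfl⟩
      exact ⟨a ++ u, ⟨a, ha, u, hu, rfl⟩, v, hv, by simp⟩
    · rintro ⟨_, ⟨a, ha, u, hu, rfl⟩, v, hv, rfl⟩
      exact ⟨a, ha, u ++ v, ⟨u, hu, v, hv, rfl⟩, by simp⟩

theorem append_mem_interpSeq {L : Set (List ℕ)} {Γ Δ : List Fm0} {u v : List ℕ}
    (hu : u ∈ interpSeq L Γ) (hv : v ∈ interpSeq L Δ) : u ++ v ∈ interpSeq L (Γ ++ Δ) :=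
  mem_interpSeq_append.2 ⟨u, hu, v, hv, rfl⟩

theorem append_mem_interpSeq_cons {L : Set (List ℕ)} {A : Fm0} {Δ : List Fm0} {u v : List ℕ}
    (hu : u ∈ interp L A) (hv : v ∈ interpSeq L Δ) : u ++ v ∈ interpSeq L (A :: Δ) :=
  ⟨u, hu, v, hv, rfl⟩

theorem interpSeq_singleton (L : Set (List ℕ)) (A : Fm0) : interpSeq L [A] = interp L A := by
  ext w
  simp [mem_interpSeq_cons]

/-- A formula interpreted by a closure may be replaced by the generators of the closure. -/
theorem interpSeq_subset_of_contextClosure {L X C : Set (List ℕ)} (hC : ContextClosed L C)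
    {A : Fm0} (hA : interp L A = contextClosure L X) {Δ₁ Δ₂ : List Fm0}
    (h : ∀ u ∈ interpSeq L Δ₁, ∀ x ∈ X, ∀ v ∈ interpSeq L Δ₂, u ++ x ++ v ∈ C) :
    interpSeq L (Δ₁ ++ A :: Δ₂) ⊆ C := by
  intro w hw
  obtain ⟨u, hu, _, ⟨a, ha, v, hv, rfl⟩, rfl⟩ := mem_interpSeq_append.1 hw
  rw [hA] at ha
  simpa using append_mem_of_mem_contextClosure hC (fun x hx => h u hu x hx v hv) ha

theorem interpSeq_bang_subset {L C : Set (List ℕ)} (hC : ContextClosed L C) {A : Fm0}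
    {Δ₁ Δ₂ : List Fm0} (h : [] ∈ interp L A → interpSeq L (Δ₁ ++ Δ₂) ⊆ C) :
    interpSeq L (Δ₁ ++ Fm0.bang A :: Δ₂) ⊆ C := by
  refine interpSeq_subset_of_contextClosure hC rfl ?_
  rintro u hu _ ⟨rfl, hA⟩ v hv
  simpa using h hA (append_mem_interpSeq hu hv)

theorem nil_mem_interp_bang {L : Set (List ℕ)} {A : Fm0} (h : [] ∈ interp L A) :
    [] ∈ interp L (Fm0.bang A) :=
  subset_contextClosure _ _ ⟨rfl, h⟩

theorem interpSeq_subset_bang {L : Set (List ℕ)} {A : Fm0} (h : [] ∈ interp L A)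
    (Δ₁ Δ₂ : List Fm0) :
    interpSeq L (Δ₁ ++ Δ₂) ⊆ interpSeq L (Δ₁ ++ Fm0.bang A :: Δ₂) := by
  intro w hw
  obtain ⟨u, hu, v, hv, rfl⟩ := mem_interpSeq_append.1 hw
  exact append_mem_interpSeq hu (append_mem_interpSeq_cons (nil_mem_interp_bang h) hv)

theorem interpSeq_map_bang_subset {L C : Set (List ℕ)} (hC : ContextClosed L C) (Φ : List Fm0)
    (h : (∀ A ∈ Φ, [] ∈ interp L A) → [] ∈ C) : interpSeq L (Φ.map Fm0.bang) ⊆ C := by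
  induction Φ with
  | nil =>
    rintro w rfl
    exact h (by simp)
  | cons A Φ ih =>
    exact interpSeq_bang_subset (Δ₁ := []) hC fun hA => ih fun hΦ => h (by simpa using ⟨hA, hΦ⟩)

theorem nil_mem_interpSeq_map_bang {L : Set (List ℕ)} {Φ : List Fm0}
    (h : ∀ A ∈ Φ, [] ∈ interp L A) : [] ∈ interpSeq L (Φ.map Fm0.bang) := by
  induction Φ with
  | nil => rfl
  | cons A Φ ih =>
    simp only [List.mem_cons, forall_eq_or_imp] at h
    exact append_mem_interpSeq_cons (nil_mem_interp_bang h.1) (ih h.2)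

/-- Soundness of `!wL1` with cut. -/
theorem DervL.interpSeq_subset {w cf : Bool} {Γ : List Fm0} {A : Fm0} (L : Set (List ℕ))
    (h : DervL w cf Γ A) : interpSeq L Γ ⊆ interp L A := by
  induction h with
  | id _ _ A => rw [interpSeq_singleton]
  | one_r => exact subset_contextClosure _ _
  | rdiv_l _ _ Γ Δ₁ Δ₂ B C D _ _ ih₁ ih₂ =>
    intro z hz
    obtain ⟨u, hu, _, ⟨a, ha, _, hy, rfl⟩, rfl⟩ := mem_interpSeq_append.1 hz
    obtain ⟨g, hg, v, hv, rfl⟩ := mem_interpSeq_append.1 hy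
    apply ih₂
    rw [← List.append_assoc a]
    exact append_mem_interpSeq hu (append_mem_interpSeq_cons (ha g (ih₁ hg)) hv)
  | rdiv_r _ _ Γ B C _ ih =>
    intro z hz u hu
    exact ih (append_mem_interpSeq hz (by rwa [interpSeq_singleton]))
  | ldiv_l _ _ Γ Δ₁ Δ₂ A C D _ _ ih₁ ih₂ =>
    intro z hz
    obtain ⟨_, hy, _, ⟨a, ha, v, hv, rfl⟩, rfl⟩ := mem_interpSeq_append.1 hz
    obtain ⟨u, hu, g, hg, rfl⟩ := mem_interpSeq_append.1 hy
    apply ih₂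
    rw [List.append_assoc u, ← List.append_assoc g]
    exact append_mem_interpSeq hu (append_mem_interpSeq_cons (ha g (ih₁ hg)) hv)
  | ldiv_r _ _ Γ A C _ ih =>
    intro z hz u hu
    exact ih (append_mem_interpSeq_cons hu hz)
  | mul_l _ _ Δ₁ Δ₂ A B D _ ih =>
    refine interpSeq_subset_of_contextClosure (contextClosed_interp L D) rfl ?_
    rintro u hu _ ⟨a, ha, b, hb, rfl⟩ v hv
    rw [List.append_assoc u, List.append_assoc a]
    exact ih (append_mem_interpSeq hu
      (append_mem_interpSeq_cons ha (append_mem_interpSeq_cons hb hv)))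
  | mul_r _ _ Γ₁ Γ₂ A B _ _ ih₁ ih₂ =>
    intro z hz
    obtain ⟨u, hu, v, hv, rfl⟩ := mem_interpSeq_append.1 hz
    exact subset_contextClosure _ _ ⟨u, ih₁ hu, v, ih₂ hv, rfl⟩
  | one_l _ _ Δ₁ Δ₂ A _ ih =>
    refine interpSeq_subset_of_contextClosure (contextClosed_interp L A) rfl ?_
    rintro u hu _ rfl v hv
    simpa using ih (append_mem_interpSeq hu hv)
  | bang_l _ _ Δ₁ Δ₂ A B _ ih =>
    refine interpSeq_bang_subset (contextClosed_interp L B) fun hA z hz => ih ?_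
    obtain ⟨u, hu, v, hv, rfl⟩ := mem_interpSeq_append.1 hz
    exact append_mem_interpSeq hu (append_mem_interpSeq_cons hA hv)
  | bang_r _ _ Φ A _ ih =>
    exact interpSeq_map_bang_subset (contextClosed_interp L _) Φ fun hΦ =>
      nil_mem_interp_bang (ih (nil_mem_interpSeq_map_bang hΦ))
  | perm1 _ _ Δ₁ Γ Δ₂ A B _ ih =>
    refine interpSeq_bang_subset (contextClosed_interp L B) fun hA => ?_
    rw [List.append_assoc]
    exact (interpSeq_subset_bang hA _ _).trans ih
  | perm2 _ _ Δ₁ Γ Δ₂ A B _ ih =>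
    refine interpSeq_bang_subset (contextClosed_interp L B) fun hA => ?_
    rw [← List.append_assoc]
    exact (interpSeq_subset_bang hA _ _).trans ih
  | contr _ _ Δ₁ Δ₂ A B _ ih =>
    exact interpSeq_bang_subset (contextClosed_interp L B) fun hA =>
      ((interpSeq_subset_bang hA _ _).trans (interpSeq_subset_bang hA _ _)).trans ih
  | weak _ Δ₁ Δ₂ A B _ ih =>
    exact interpSeq_bang_subset (contextClosed_interp L B) fun _ => ih
  | cut _ Θ Δ₁ Δ₂ A C _ _ ih₁ ih₂ =>
    intro z hz
    obtain ⟨_, hy, v, hv, rfl⟩ := mem_interpSeq_append.1 hz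
    obtain ⟨u, hu, g, hg, rfl⟩ := mem_interpSeq_append.1 hy
    rw [List.append_assoc]
    exact ih₂ (append_mem_interpSeq hu (append_mem_interpSeq_cons (ih₁ hg) hv))

theorem mem_interpSeq_map_var (L : Set (List ℕ)) (l : List ℕ) :
    l ∈ interpSeq L (l.map Fm0.var) := by
  induction l with
  | nil => rfl
  | cons a l ih => exact ⟨[a], subset_contextClosure _ _ rfl, l, ih, rfl⟩

theorem mem_interp_wordFm0 (L : Set (List ℕ)) (l : List ℕ) : l ∈ interp L (wordFm0 l) := by
  induction l using wordFm0.induct with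
  | case1 => exact subset_contextClosure _ _ rfl
  | case2 a => exact subset_contextClosure _ _ rfl
  | case3 a b l ih =>
    exact subset_contextClosure _ _ ⟨[a], subset_contextClosure _ _ rfl, b :: l, ih, rfl⟩

theorem interp_wordFm0_subset {L C : Set (List ℕ)} (hC : ContextClosed L C) {u v l : List ℕ}
    (h : u ++ l ++ v ∈ C) {w : List ℕ} (hw : w ∈ interp L (wordFm0 l)) : u ++ w ++ v ∈ C := by
  induction l using wordFm0.induct generalizing u w with
  | case1 => exact append_mem_of_mem_contextClosure hC (by simpa using h) hw
  | case2 a => exact append_mem_of_mem_contextClosure hC (by simpa using h) hw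
  | case3 a b l ih =>
    refine append_mem_of_mem_contextClosure hC ?_ hw
    rintro _ ⟨y, hy, z, hz, rfl⟩
    rw [← List.append_assoc]
    refine ih ?_ hz
    rw [List.append_assoc]
    exact append_mem_of_mem_contextClosure hC (by simpa using h) hy

theorem nil_mem_interp_prodFm0 {L : Set (List ℕ)} {p : List ℕ × List ℕ}
    (h : ∀ x y, x ++ p.1 ++ y ∈ L → x ++ p.2 ++ y ∈ L) : [] ∈ interp L (prodFm0 p) := by
  intro w hw
  have := interp_wordFm0_subset (contextClosed_interp L (wordFm0 p.1)) (u := []) (v := [])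
    (l := p.2) (by
      simpa using contextClosed_interp L (wordFm0 p.1) fun x y hxy =>
        h x y (hxy _ (mem_interp_wordFm0 L p.1))) hw
  simpa using this

theorem DervT.wordFm1_left {T : Set Seq1} {Δ₁ Δ₂ : List Fm1} {C : Fm1} {l : List ℕ}
    (h : DervT T (Δ₁ ++ l.map Fm1.var ++ Δ₂) C) : DervT T (Δ₁ ++ wordFm1 l :: Δ₂) C := by
  induction l using wordFm1.induct generalizing Δ₁ with
  | case1 => exact .one_l _ _ _ (by simpa using h)
  | case2 a => simpa [wordFm1] using h
  | case3 a b l ih =>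
    refine .mul_l _ _ _ _ _ ?_
    have := ih (Δ₁ := Δ₁ ++ [Fm1.var a]) (by simpa using h)
    simpa using this

/-- If `Γ_G, a₁, …, aₙ → s` is derivable in `!wL1`, then
`a₁, …, aₙ → s` is derivable in `L1 + T_G`. -/
theorem wL_to_theory (G : Grammar) (hne : G.NonemptySides)
    (as : List ℕ) (has : ∀ a ∈ as, a ∈ G.terminals)
    (h : DervL true true (GammaG G ++ as.map Fm0.var) (Fm0.var G.start)) :
    DervT (TG G) (as.map Fm1.var) (Fm1.var G.start) := by
  let L : Set (List ℕ) := { w | DervT (TG G) (w.map Fm1.var) (Fm1.var G.start) }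
  have hprod : ∀ A ∈ G.prods.toList.map prodFm0, [] ∈ interp L A := by
    simp only [List.mem_map, Finset.mem_toList]
    rintro _ ⟨p, hp, rfl⟩
    refine nil_mem_interp_prodFm0 fun x y hxy => ?_
    have hu : DervT (TG G) (x.map Fm1.var ++ wordFm1 p.1 :: y.map Fm1.var) (Fm1.var G.start) :=
      DervT.wordFm1_left (by simpa [L] using hxy)
    have hax : (p.2.map Fm1.var, wordFm1 p.1) ∈ TG G := ⟨p, hp, rfl⟩
    simpa [L] using DervT.cut _ _ _ _ _ (.ax _ _ hax) hu
  have hΓ : [] ∈ interpSeq L (GammaG G) := by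
    simpa [GammaG, Function.comp_def] using nil_mem_interpSeq_map_bang hprod
  have hs : as ∈ interp L (Fm0.var G.start) :=
    h.interpSeq_subset L (append_mem_interpSeq hΓ (mem_interpSeq_map_var L as))
  have := hs [] [] (by simpa [L] using DervT.id _)
  simpa [L] using this

end Lambek
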